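/- Let m ≥ 1, s ∈ (0,1], p ∈ [1,∞), r ∈ (0,1], q ∈ [1,∞) with rq = sp ≤ m, let N and F be metric spaces with N Lipschitz-path-connected, and let f : N → F be Borel measurable. Suppose there is a constant C₁ > 0 such that E_{r,q}(f∘u, B^m) ≤ C₁ · E_{s,p}(u, B^m) for every measurable u : B^m → N with finite E_{s,p}-energy. Then there exists C ≥ 0 such that for every x, y ∈ N with (in case sp = m) d_N(x,y) ≤ 1/C, one has d_F(f(x), f(y)) ≤ C · d_N(x,y)^{p/q}. -/

import Mathlib

open MeasureTheory ENNReal Metric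

/-- The metric slope (local Lipschitz constant) of a map between metric spaces. -/
noncomputable def metricSlope {E N : Type} [MetricSpace E] [MetricSpace N]
    (v : E → N) (x : E) : ℝ≥0∞ :=
  Filter.limsup (fun y => ENNReal.ofReal (dist (v x) (v y) / dist x y))
    (nhdsWithin x {x}ᶜ)

/-- The homogeneous `W^{s,p}` energy, `s ∈ (0,1]`, of a map into a metric space `N`:
for `s = 1` the `p`-energy of the metric slope, otherwise the Gagliardo energy. -/
noncomputable def sobolevEnergy {m : ℕ} {N : Type} [MetricSpace N] (s p : ℝ)
    (v : EuclideanSpace ℝ (Fin m) → N) (A : Set (EuclideanSpace ℝ (Fin m))) : ℝ≥0∞ :=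
  if s = 1 then ∫⁻ x in A, (metricSlope v x) ^ p
  else ∫⁻ x in A, ∫⁻ y in A,
    ENNReal.ofReal (dist (v x) (v y) ^ p / ‖x - y‖ ^ ((m : ℝ) + s * p))

/-- A metric space is Lipschitz-path-connected with controlled constants if any two points
`x, y` are joined by a path `γ : [-1,1] → N` with `Lip(γ) ≤ d(x,y)`. -/
def LipschitzPathConnected (N : Type) [MetricSpace N] : Prop :=
  ∀ x y : N, ∃ γ : ℝ → N, γ (-1) = x ∧ γ 1 = y ∧
    LipschitzWith (Real.toNNReal (dist x y)) γ

/-- A lower bound for the difference quotients at points arbitrarily close to `x` bounds the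
metric slope from below. -/
lemma ofReal_le_metricSlope {E N : Type} [MetricSpace E] [MetricSpace N] {v : E → N} {x : E}
    {c : ℝ} (h : ∀ δ > 0, ∃ y, y ≠ x ∧ dist y x < δ ∧ c * dist x y ≤ dist (v x) (v y)) :
    ENNReal.ofReal c ≤ metricSlope v x := by
  refine Filter.le_limsup_of_frequently_le' ?_
  rw [Filter.frequently_iff]
  intro U hU
  obtain ⟨δ, hδ, hU⟩ := Metric.mem_nhdsWithin_iff.1 hU
  obtain ⟨y, hyx, hy, hc⟩ := h δ hδ
  refine ⟨y, hU ⟨hy, hyx⟩, ENNReal.ofReal_le_ofReal ?_⟩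
  rwa [le_div_iff₀ (dist_pos.2 hyx.symm)]

lemma LipschitzWith.metricSlope_le {E N : Type} [MetricSpace E] [MetricSpace N] {v : E → N}
    {K : NNReal} (hv : LipschitzWith K v) (x : E) : metricSlope v x ≤ K := by
  refine Filter.limsup_le_of_le (h := ?_)
  filter_upwards [self_mem_nhdsWithin] with y hy
  rw [← ENNReal.ofReal_coe_nnreal]
  refine ENNReal.ofReal_le_ofReal ?_
  rw [div_le_iff₀ (dist_pos.2 (Ne.symm hy))]
  exact hv.dist_le_mul x y

/-- The Riesz kernel `‖z‖ ^ (a - m)`, `a > 0`, has finite integral over a ball. -/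
lemma lintegral_norm_rpow_sub_finrank_lt_top {m : ℕ} (hm : 1 ≤ m) {a : ℝ} (ha : 0 < a) (R : ℝ) :
    ∫⁻ z in ball (0 : EuclideanSpace ℝ (Fin m)) R, ENNReal.ofReal (‖z‖ ^ (a - m)) < ⊤ := by
  have h : IntegrableOn (fun z : EuclideanSpace ℝ (Fin m) => ‖z‖ ^ (a - m)) (ball 0 R) := by
    refine integrableOn_ball_of_norm_le_rpow (C := 1) (α := m - a) (by simpa using hm)
      (by simpa using ha) (Filter.Eventually.of_forall fun x => ?_) ?_
    · rw [Real.norm_of_nonneg (by positivity), one_mul, neg_sub]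
    · exact (measurable_norm.pow_const _).aestronglyMeasurable
  exact h.lintegral_lt_top

/-- Lipschitz maps have finite energy on the unit ball, `p`-homogeneous in the Lipschitz
constant. -/
lemma exists_sobolevEnergy_le_of_lipschitzWith {m : ℕ} (hm : 1 ≤ m) {s p : ℝ}
    (hs : s ∈ Set.Ioc (0 : ℝ) 1) (hp : 1 ≤ p) :
    ∃ C : ℝ, 0 ≤ C ∧ ∀ (N : Type) [MetricSpace N] (K : NNReal)
      (v : EuclideanSpace ℝ (Fin m) → N), LipschitzWith K v →
        sobolevEnergy s p v (ball 0 1) ≤ ENNReal.ofReal (C * (K : ℝ) ^ p) := by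
  have hvol : volume (ball (0 : EuclideanSpace ℝ (Fin m)) 1) ≠ ⊤ := measure_ball_lt_top.ne
  have hp0 : 0 ≤ p := by linarith
  rcases eq_or_ne s 1 with rfl | hs1
  · refine ⟨(volume (ball (0 : EuclideanSpace ℝ (Fin m)) 1)).toReal, toReal_nonneg, ?_⟩
    intro N _ K v hv
    rw [sobolevEnergy, if_pos rfl, ENNReal.ofReal_mul toReal_nonneg, ENNReal.ofReal_toReal hvol,
      ← ENNReal.ofReal_rpow_of_nonneg K.coe_nonneg hp0, ENNReal.ofReal_coe_nnreal, mul_comm,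
      ← setLIntegral_const]
    exact lintegral_mono fun x => ENNReal.rpow_le_rpow (hv.metricSlope_le x) hp0
  · have ha : 0 < p * (1 - s) := mul_pos (by linarith) (by linarith [lt_of_le_of_ne hs.2 hs1])
    set I := ∫⁻ z in ball (0 : EuclideanSpace ℝ (Fin m)) 2,
      ENNReal.ofReal (‖z‖ ^ (p * (1 - s) - m)) with hI
    have hIt : I < ⊤ := lintegral_norm_rpow_sub_finrank_lt_top hm ha 2
    refine ⟨(I * volume (ball (0 : EuclideanSpace ℝ (Fin m)) 1)).toReal, toReal_nonneg, ?_⟩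
    intro N _ K v hv
    rw [sobolevEnergy, if_neg hs1, ENNReal.ofReal_mul toReal_nonneg,
      ENNReal.ofReal_toReal (mul_ne_top hIt.ne hvol), ← mul_comm (ENNReal.ofReal _),
      ← mul_assoc, ← setLIntegral_const]
    refine setLIntegral_mono' measurableSet_ball fun x hx => ?_
    have hpt : ∀ y, ENNReal.ofReal (dist (v x) (v y) ^ p / ‖x - y‖ ^ ((m : ℝ) + s * p)) ≤
        ENNReal.ofReal ((K : ℝ) ^ p) * ENNReal.ofReal (‖x - y‖ ^ (p * (1 - s) - m)) := by
      intro y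
      rw [← ENNReal.ofReal_mul (by positivity)]
      refine ENNReal.ofReal_le_ofReal ?_
      rcases eq_or_ne x y with rfl | hxy
      · rw [dist_self, Real.zero_rpow (by linarith), zero_div]
        positivity
      · have hpos : 0 < ‖x - y‖ := norm_pos_iff.2 (sub_ne_zero.2 hxy)
        have h1 : p * (1 - s) - m = p - (m + s * p) := by ring
        rw [h1, Real.rpow_sub hpos, ← mul_div_assoc, ← Real.mul_rpow K.coe_nonneg hpos.le,
          ← dist_eq_norm]
        have := hv.dist_le_mul x y
        gcongr
    calc _ ≤ ∫⁻ y in ball 0 1, ENNReal.ofReal ((K : ℝ) ^ p) *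
          ENNReal.ofReal (‖x - y‖ ^ (p * (1 - s) - m)) := lintegral_mono hpt
      _ = ENNReal.ofReal ((K : ℝ) ^ p) * ∫⁻ y in ball 0 1,
          ENNReal.ofReal (‖x - y‖ ^ (p * (1 - s) - m)) :=
        lintegral_const_mul' _ _ ofReal_ne_top
      _ ≤ ENNReal.ofReal ((K : ℝ) ^ p) * I := by
        gcongr
        rw [hI, ← lintegral_indicator measurableSet_ball, ← lintegral_indicator measurableSet_ball,
          ← lintegral_sub_left_eq_self
            ((ball (0 : EuclideanSpace ℝ (Fin m)) 2).indicator _) x]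
        refine lintegral_mono fun y => ?_
        by_cases hy : y ∈ ball (0 : EuclideanSpace ℝ (Fin m)) 1
        · have : x - y ∈ ball (0 : EuclideanSpace ℝ (Fin m)) 2 := by
            rw [mem_ball_zero_iff] at *
            linarith [norm_sub_le x y]
          simp [hy, Set.indicator_of_mem this]
        · simp [hy]

/-- If `g` is discontinuous at `t₀`, composing it with a suitable `1`-Lipschitz function whose
`t₀`-level set is nowhere dense with positive measure produces a map of infinite slope energy. -/
lemma exists_lipschitzWith_sobolevEnergy_eq_top {m : ℕ} (hm : 1 ≤ m) {q : ℝ} (hq : 1 ≤ q)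
    {F : Type} [MetricSpace F] {g : ℝ → F} {t₀ : ℝ} (hg : ¬ ContinuousAt g t₀) :
    ∃ w : EuclideanSpace ℝ (Fin m) → ℝ, LipschitzWith 1 w ∧
      sobolevEnergy 1 q (g ∘ w) (ball 0 1) = ⊤ := by
  obtain ⟨ε, hε, σ, hσ, hjump⟩ : ∃ ε > 0, ∃ σ : ℝ, |σ| ≤ 1 ∧ ∀ η > 0, ∃ t, 0 < t ∧ t < η ∧
      ε ≤ dist (g t₀) (g (t₀ + σ * t)) := by
    by_contra! hcon
    refine hg (Metric.continuousAt_iff.2 fun ε hε => ?_)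
    obtain ⟨η₁, hη₁, h₁⟩ := hcon ε hε 1 (by simp)
    obtain ⟨η₂, hη₂, h₂⟩ := hcon ε hε (-1) (by simp)
    refine ⟨min η₁ η₂, lt_min hη₁ hη₂, fun {t} ht => ?_⟩
    rw [Real.dist_eq, lt_min_iff, abs_lt, abs_lt] at ht
    rw [dist_comm]
    rcases lt_trichotomy t t₀ with h | rfl | h
    · have := h₂ (t₀ - t) (by linarith) (by linarith)
      rwa [show t₀ + -1 * (t₀ - t) = t by ring] at this
    · simpa using hε
    · have := h₁ (t - t₀) (by linarith) (by linarith)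
      rwa [show t₀ + 1 * (t - t₀) = t by ring] at this
  obtain ⟨S, hSc, hSd⟩ := TopologicalSpace.exists_countable_dense (EuclideanSpace ℝ (Fin m))
  have : Nonempty (Fin m) := ⟨⟨0, hm⟩⟩
  obtain ⟨U, hSU, hUo, hUm⟩ := S.exists_isOpen_lt_of_lt (μ := volume)
    (volume (ball (0 : EuclideanSpace ℝ (Fin m)) 1))
    (by rw [hSc.measure_zero]; exact measure_ball_pos _ _ one_pos)
  set w : EuclideanSpace ℝ (Fin m) → ℝ := fun x => t₀ + σ * infDist x Uᶜ with hw
  refine ⟨w, LipschitzWith.of_dist_le_mul fun x y => ?_, ?_⟩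
  · rw [hw, dist_add_left, Real.dist_eq, ← mul_sub, abs_mul, NNReal.coe_one, one_mul]
    calc |σ| * |infDist x Uᶜ - infDist y Uᶜ| ≤ 1 * dist x y := by
          gcongr
          simpa [Real.dist_eq] using (lipschitz_infDist_pt Uᶜ).dist_le_mul x y
      _ = _ := one_mul _
  have hslope : ∀ x ∈ Uᶜ, metricSlope (g ∘ w) x = ⊤ := by
    intro x hx
    refine ENNReal.eq_top_of_forall_nnreal_le fun c => ?_
    rw [← ENNReal.ofReal_coe_nnreal]
    refine ofReal_le_metricSlope fun δ hδ => ?_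
    set δ' : ℝ := min δ (ε / (c + 1))
    have hc1 : (0 : ℝ) < c + 1 := by positivity
    have hδ'0 : 0 < δ' := lt_min hδ (by positivity)
    obtain ⟨y, hyS, hy⟩ := hSd.exists_dist_lt x hδ'0
    have hy0 : 0 < infDist y Uᶜ :=
      (hUo.isClosed_compl.notMem_iff_infDist_pos ⟨x, hx⟩).1 (by simpa using hSU hyS)
    obtain ⟨t, ht0, ht, htε⟩ := hjump _ hy0
    have hconn : IsPreconnected (ball x δ') := (convex_ball x δ').isPreconnected
    obtain ⟨z, hz, hzt⟩ := hconn.intermediate_value (mem_ball_self hδ'0)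
      (by rwa [mem_ball, dist_comm]) (continuous_infDist_pt Uᶜ).continuousOn
      (⟨by rw [infDist_zero_of_mem hx]; exact ht0.le, ht.le⟩ : t ∈ Set.Icc _ _)
    replace hzt : infDist z Uᶜ = t := hzt
    have hzd : dist x z < δ' := by rw [dist_comm]; exact hz
    refine ⟨z, ?_, by rw [dist_comm]; exact hzd.trans_le (min_le_left _ _), ?_⟩
    · rintro rfl
      rw [infDist_zero_of_mem hx] at hzt
      exact ht0.ne hzt
    · have h1 : dist ((g ∘ w) x) ((g ∘ w) z) = dist (g t₀) (g (t₀ + σ * t)) := by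
        simp only [Function.comp, hw, hzt, infDist_zero_of_mem hx, mul_zero, add_zero]
      rw [h1]
      refine le_trans ?_ htε
      have h2 : dist x z ≤ ε / (c + 1) := (hzd.trans_le (min_le_right _ _)).le
      rw [le_div_iff₀ hc1] at h2
      linarith [dist_nonneg (x := x) (y := z)]
  have hpos : volume (ball (0 : EuclideanSpace ℝ (Fin m)) 1 ∩ Uᶜ) ≠ 0 := by
    intro h0
    have := measure_le_inter_add_sdiff volume (ball (0 : EuclideanSpace ℝ (Fin m)) 1) Uᶜ
    rw [h0, zero_add] at this
    refine (this.trans (measure_mono ?_)).not_gt hUm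
    intro x hx
    simpa using hx.2
  rw [sobolevEnergy, if_pos rfl, eq_top_iff]
  calc (⊤ : ℝ≥0∞) = ∫⁻ x in ball (0 : EuclideanSpace ℝ (Fin m)) 1 ∩ Uᶜ, ⊤ := by
        rw [setLIntegral_const, ENNReal.top_mul hpos]
    _ ≤ ∫⁻ x in ball (0 : EuclideanSpace ℝ (Fin m)) 1 ∩ Uᶜ, metricSlope (g ∘ w) x ^ q := by
        refine setLIntegral_mono' (measurableSet_ball.inter hUo.measurableSet.compl) ?_
        intro x hx
        rw [hslope x hx.2, ENNReal.top_rpow_of_pos (by linarith)]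
    _ ≤ _ := lintegral_mono_set Set.inter_subset_left

/-- A continuous `g` interpolating between the constants `a` and `b` can be reparametrized by a
`1`-Lipschitz `h` in such a way that the normalized running maximum `V` of the distance of `g ∘ h`
to `a` becomes `1`-Lipschitz. Every increase of `V` is realized by `g ∘ h`. -/
lemma exists_reparametrization {F : Type} [MetricSpace F] {g : ℝ → F} (hg : Continuous g)
    {a b : F} (hab : a ≠ b) (ha : ∀ t ≤ -1, g t = a) (hb : ∀ t ≥ 1, g t = b) :
    ∃ h V : ℝ → ℝ, LipschitzWith 1 h ∧ LipschitzWith 1 V ∧ Monotone V ∧ V (-1) = 0 ∧ V 2 = 1 ∧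
      ∀ x y, x < y → V x < V y →
        ∃ z, x < z ∧ z ≤ y ∧ dist a b * (V y - V x) ≤ dist (g (h x)) (g (h z)) := by
  have hD : 0 < dist a b := dist_pos.2 hab
  set G : ℝ → ℝ := fun t => min 1 (dist a (g t) / dist a b) with hG
  have hGc : Continuous G := by fun_prop
  have hG0 : ∀ t, 0 ≤ G t := fun t => le_min zero_le_one (by positivity)
  have hG1 : ∀ t, G t ≤ 1 := fun t => min_le_left _ _
  have hGa : ∀ t ≤ -1, G t = 0 := fun t ht => by simp [hG, ha t ht]
  have hGb : ∀ t ≥ 1, G t = 1 := fun t ht => by simp [hG, hb t ht, hD.ne']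
  set M : ℝ → ℝ := fun t => sSup ((fun s => G (min s t)) '' Set.Icc (-1) 1) with hM
  have hMc : Continuous M :=
    isCompact_Icc.continuous_sSup (f := fun t s => G (min s t))
      (hGc.comp (continuous_snd.min continuous_fst))
  have hMatt : ∀ t, ∃ τ ≤ t, G τ = M t := by
    intro t
    obtain ⟨s, -, hs⟩ := (isCompact_Icc (a := (-1 : ℝ)) (b := 1)).exists_sSup_image_eq
      ⟨-1, by norm_num⟩ (hGc.comp (continuous_id.min (continuous_const (y := t)))).continuousOn
    exact ⟨min s t, min_le_right _ _, hs.symm⟩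
  have hMub : ∀ t, ∀ s ∈ Set.Icc (-1 : ℝ) 1, G (min s t) ≤ M t := fun t s hs =>
    le_csSup ⟨1, by rintro _ ⟨s, -, rfl⟩; exact hG1 _⟩ ⟨s, hs, rfl⟩
  have hM0 : ∀ t, 0 ≤ M t := fun t => by
    obtain ⟨τ, -, h⟩ := hMatt t
    exact h ▸ hG0 τ
  have hM1 : ∀ t, M t ≤ 1 := fun t => by
    obtain ⟨τ, -, h⟩ := hMatt t
    exact h ▸ hG1 τ
  have hGM : ∀ τ t, τ ≤ t → G τ ≤ M t := by
    intro τ t hτ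
    rcases le_total τ (-1) with h1 | h1
    · rw [hGa τ h1]; exact hM0 t
    rcases le_total τ 1 with h2 | h2
    · simpa [min_eq_left hτ] using hMub t τ ⟨h1, h2⟩
    · have := hMub t 1 (by norm_num)
      rw [min_eq_left (h2.trans hτ), hGb 1 le_rfl] at this
      exact (hG1 τ).trans this
  have hMmono : Monotone M := by
    intro t t' h
    obtain ⟨τ, hτ, hτ'⟩ := hMatt t
    exact hτ' ▸ hGM τ t' (hτ.trans h)
  have hMa : M (-1) = 0 := by
    obtain ⟨τ, hτ, h⟩ := hMatt (-1)
    rw [← h, hGa τ hτ]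
  have hMb : M 1 = 1 := le_antisymm (hM1 1) ((hGb 1 le_rfl).ge.trans (hGM 1 1 le_rfl))
  set H : ℝ → ℝ := fun t => t + M t with hH
  have hHmono : StrictMono H := strictMono_id.add_monotone hMmono
  have hHsurj : Function.Surjective H := by
    refine (continuous_id.add hMc).surjective ?_ ?_
    · exact Filter.tendsto_atTop_mono (fun t => by simpa using hM0 t) Filter.tendsto_id
    · exact Filter.tendsto_atBot_mono (fun t => by simpa using hM1 t)
        (Filter.tendsto_atBot_add_const_right _ 1 Filter.tendsto_id)
  set e := hHmono.orderIsoOfSurjective H hHsurj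
  have hes : ∀ x, e.symm x + M (e.symm x) = x := fun x => e.apply_symm_apply x
  have hdiff : ∀ x y, |e.symm x - e.symm y| ≤ |x - y| ∧
      |M (e.symm x) - M (e.symm y)| ≤ |x - y| := by
    intro x y
    have hx := hes x
    have hy := hes y
    rcases le_total x y with h | h
    · have h1 := e.symm.monotone h
      have h2 := hMmono h1
      constructor <;> rw [abs_sub_comm, abs_sub_comm x, abs_of_nonneg (by linarith),
        abs_of_nonneg (by linarith)] <;> linarith
    · have h1 := e.symm.monotone h
      have h2 := hMmono h1
      constructor <;> rw [abs_of_nonneg (by linarith), abs_of_nonneg (by linarith)] <;> linarith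
  have hsymm : ∀ t, e.symm (t + M t) = t := fun t => e.symm_apply_apply t
  refine ⟨e.symm, fun x => M (e.symm x), ?_, ?_, hMmono.comp e.symm.monotone, ?_, ?_, ?_⟩
  · exact LipschitzWith.of_dist_le_mul fun x y => by simpa [Real.dist_eq] using (hdiff x y).1
  · exact LipschitzWith.of_dist_le_mul fun x y => by simpa [Real.dist_eq] using (hdiff x y).2
  · have := hsymm (-1)
    rw [hMa, add_zero] at this
    simp only [this, hMa]
  · have := hsymm 1
    rw [hMb, one_add_one_eq_two] at this
    simp only [this, hMb]
  · intro x y hxy hV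
    obtain ⟨τ, hτ, hτM⟩ := hMatt (e.symm y)
    have hxτ : e.symm x < τ := by
      by_contra! hcon
      exact (hGM τ _ hcon).not_gt (hτM ▸ hV)
    refine ⟨e τ, e.symm_apply_lt.1 hxτ, e.le_symm_apply.1 hτ, ?_⟩
    rw [e.symm_apply_apply, mul_comm, ← le_div_iff₀ hD]
    have h1 : M (e.symm y) - M (e.symm x) ≤ G τ - G (e.symm x) := by
      linarith [hGM _ _ (le_refl (e.symm x))]
    refine h1.trans ?_
    have h2 : dist a (g τ) / dist a b ≤ dist a (g (e.symm x)) / dist a b +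
        dist (g (e.symm x)) (g τ) / dist a b := by
      rw [← add_div]
      gcongr
      exact dist_triangle _ _ _
    have h3 : 0 ≤ dist (g (e.symm x)) (g τ) / dist a b := by positivity
    simp only [hG]
    rcases le_total 1 (dist a (g (e.symm x)) / dist a b) with h | h
    · rw [min_eq_left h]
      linarith [min_le_left 1 (dist a (g τ) / dist a b)]
    · rw [min_eq_right h]
      linarith [min_le_right 1 (dist a (g τ) / dist a b)]

/-- The integral of a function of one coordinate over the unit ball dominates a multiple of its
integral over an interval. -/
lemma exists_mul_lintegral_le_lintegral_ball {m : ℕ} (i : Fin m) :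
    ∃ a : ℝ, 0 < a ∧ ∃ c : ℝ≥0∞, c ≠ 0 ∧ ∀ φ : ℝ → ℝ≥0∞, Measurable φ →
      c * ∫⁻ t in Set.Icc (-a) a, φ t ≤
        ∫⁻ x in ball (0 : EuclideanSpace ℝ (Fin m)) 1, φ (x i) := by
  classical
  have hm : 0 < m := i.pos
  have hm' : (1 : ℝ) ≤ m := by exact_mod_cast hm
  set a : ℝ := 1 / (2 * m) with ha
  have ha0 : 0 < a := by positivity
  refine ⟨a, ha0, ∏ _j ∈ Finset.univ.erase i, volume.restrict (Set.Icc (-a) a) Set.univ, ?_, ?_⟩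
  · refine Finset.prod_ne_zero_iff.2 fun j _ => ?_
    rw [Measure.restrict_apply_univ, Real.volume_Icc]
    simpa using ha0
  intro φ hφ
  set Q : Set (Fin m → ℝ) := Set.univ.pi fun _ => Set.Icc (-a) a with hQ
  have hQm : MeasurableSet Q := MeasurableSet.univ_pi fun _ => measurableSet_Icc
  have hsub : (WithLp.ofLp : EuclideanSpace ℝ (Fin m) → _) ⁻¹' Q ⊆ ball 0 1 := by
    intro x hx
    have hx' : ∀ j, ‖x j‖ ≤ a := fun j => abs_le.2 (hx j trivial)
    rw [mem_ball_zero_iff, EuclideanSpace.norm_eq, Real.sqrt_lt' one_pos]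
    calc ∑ j, ‖x j‖ ^ 2 ≤ ∑ _j : Fin m, a ^ 2 := by
          gcongr with j
          exact hx' j
      _ = m * a ^ 2 := by simp
      _ < 1 ^ 2 := by
        rw [ha, div_pow, ← mul_div_assoc, div_lt_iff₀ (by positivity)]
        nlinarith
  calc _ = ∫⁻ t, φ t ∂(Measure.pi fun _ => volume.restrict (Set.Icc (-a) a)).map
          (Function.eval i) := by
        rw [Measure.pi_map_eval, lintegral_smul_measure, smul_eq_mul]
    _ = ∫⁻ y in Q, φ (y i) := by
        rw [lintegral_map hφ (measurable_pi_apply i), hQ, volume_pi, Measure.restrict_pi_pi]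
    _ = ∫⁻ x in (WithLp.ofLp : EuclideanSpace ℝ (Fin m) → _) ⁻¹' Q, φ (x i) :=
        ((PiLp.volume_preserving_ofLp (Fin m)).setLIntegral_comp_preimage hQm
          (hφ.comp (measurable_pi_apply i))).symm
    _ ≤ _ := lintegral_mono_set hsub

/-- A quantitative form of Hölder's inequality: a function of unit integral on an interval has
its `q`-th moment bounded below. -/
lemma exists_le_lintegral_rpow_of_lintegral_eq_one {q a : ℝ} (hq : 1 ≤ q) (ha : 0 < a) :
    ∃ c : ℝ≥0∞, c ≠ 0 ∧ ∀ φ : ℝ → ℝ, (∀ t, 0 ≤ φ t) → Measurable φ →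
      ∫⁻ t in Set.Icc (-a) a, ENNReal.ofReal (φ t) = 1 →
      c ≤ ∫⁻ t in Set.Icc (-a) a, ENNReal.ofReal (φ t) ^ q := by
  set b : ℝ := 1 / (4 * a) with hb
  have hb0 : 0 < b := by positivity
  set B : ℝ := b ^ (1 - q) with hB
  have hB0 : 0 < B := by positivity
  refine ⟨ENNReal.ofReal (1 / (2 * B)), by simpa using by positivity, fun φ h0 hφ h1 => ?_⟩
  have hpt : ∀ t, ENNReal.ofReal (φ t) ≤
      ENNReal.ofReal b + ENNReal.ofReal B * ENNReal.ofReal (φ t) ^ q := by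
    intro t
    rw [ENNReal.ofReal_rpow_of_nonneg (h0 t) (by linarith), ← ENNReal.ofReal_mul hB0.le,
      ← ENNReal.ofReal_add hb0.le (mul_nonneg hB0.le (Real.rpow_nonneg (h0 t) _))]
    refine ENNReal.ofReal_le_ofReal ?_
    have h2 : 0 ≤ φ t ^ q := Real.rpow_nonneg (h0 t) _
    rcases le_or_gt (φ t) b with h | h
    · nlinarith
    · have h3 : φ t = φ t ^ (1 - q) * φ t ^ q := by
        rw [← Real.rpow_add (hb0.trans h), sub_add_cancel, Real.rpow_one]
      have h4 : φ t ^ (1 - q) ≤ B := Real.rpow_le_rpow_of_nonpos hb0 h.le (by linarith)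
      nlinarith
  have hint := lintegral_mono (μ := volume.restrict (Set.Icc (-a) a)) hpt
  rw [h1, lintegral_add_left measurable_const, lintegral_const_mul' _ _ ofReal_ne_top,
    setLIntegral_const, Real.volume_Icc, ← ENNReal.ofReal_mul hb0.le,
    show b * (a - -a) = 1 / 2 by rw [hb]; field_simp; ring] at hint
  by_cases hfin : ∫⁻ t in Set.Icc (-a) a, ENNReal.ofReal (φ t) ^ q = ⊤
  · rw [hfin]; exact le_top
  rw [← ENNReal.ofReal_toReal hfin] at hint ⊢
  rw [← ENNReal.ofReal_mul hB0.le, ← ENNReal.ofReal_add (by norm_num) (by positivity),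
    ENNReal.one_le_ofReal] at hint
  refine ENNReal.ofReal_le_ofReal ?_
  rw [div_le_iff₀ (by positivity)]
  linarith

/-- Rescaled form of `exists_reparametrization`, adapted to an arbitrary symmetric interval. -/
lemma exists_reparametrization_Icc {a : ℝ} (ha : 0 < a) :
    ∃ k : NNReal, ∀ (F : Type) [MetricSpace F] (g : ℝ → F), Continuous g → ∀ x y : F, x ≠ y →
      (∀ t ≤ -1, g t = x) → (∀ t ≥ 1, g t = y) →
      ∃ h V : ℝ → ℝ, LipschitzWith k h ∧ LipschitzWith k V ∧ Monotone V ∧ V (-a) = 0 ∧ V a = 1 ∧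
        ∀ t t', t < t' → V t < V t' →
          ∃ z, t < z ∧ z ≤ t' ∧ dist x y * (V t' - V t) ≤ dist (g (h t)) (g (h z)) := by
  set κ : ℝ := 3 / (2 * a) with hκ
  have hκ0 : 0 < κ := by positivity
  set A : ℝ → ℝ := fun t => κ * t + 1 / 2 with hA
  have hAL : LipschitzWith κ.toNNReal A := LipschitzWith.of_dist_le_mul fun t t' => by
    rw [hA, dist_add_right, Real.dist_eq, Real.dist_eq, ← mul_sub, abs_mul, abs_of_pos hκ0,
      Real.coe_toNNReal _ hκ0.le]
  have hAm : StrictMono A := fun t t' h => by simp only [hA]; gcongr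
  have hAa : A (-a) = -1 := by simp only [hA, hκ]; field_simp; norm_num
  have hAb : A a = 2 := by simp only [hA, hκ]; field_simp; norm_num
  refine ⟨κ.toNNReal, fun F _ g hg x y hxy hx hy => ?_⟩
  obtain ⟨h, V, hh, hV, hVm, hV0, hV1, hz⟩ := exists_reparametrization hg hxy hx hy
  refine ⟨h ∘ A, V ∘ A, by simpa using hh.comp hAL, by simpa using hV.comp hAL,
    hVm.comp hAm.monotone, by simp [hAa, hV0], by simp [hAb, hV1], fun t t' ht hVt => ?_⟩
  obtain ⟨z, hz1, hz2, hz3⟩ := hz (A t) (A t') (hAm ht) hVt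
  have hAz : A ((z - 1 / 2) / κ) = z := by simp only [hA]; field_simp; ring
  refine ⟨(z - 1 / 2) / κ, hAm.lt_iff_lt.1 (hAz.symm ▸ hz1), hAm.le_iff_le.1 (hAz.symm ▸ hz2), ?_⟩
  simpa only [Function.comp, hAz] using hz3

/-- If every increase of a monotone function `V` of the coordinate `x i` is realized by `v`, then
the metric slope of `v` dominates the derivative of `V`. -/
lemma ofReal_deriv_le_metricSlope {m : ℕ} (i : Fin m) {F : Type} [MetricSpace F] {v : ℝ → F}
    {V : ℝ → ℝ} {D : ℝ} (hD : 0 ≤ D)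
    (hV : ∀ t t', t < t' → V t < V t' →
      ∃ z, t < z ∧ z ≤ t' ∧ D * (V t' - V t) ≤ dist (v t) (v z))
    (x : EuclideanSpace ℝ (Fin m)) :
    ENNReal.ofReal (D * (deriv V (x i) / 2)) ≤
      metricSlope (fun y : EuclideanSpace ℝ (Fin m) => v (y i)) x := by
  classical
  rcases le_or_gt (deriv V (x i)) 0 with h0 | h0
  · rw [ENNReal.ofReal_of_nonpos (mul_nonpos_of_nonneg_of_nonpos hD (by linarith))]
    exact zero_le
  refine ofReal_le_metricSlope fun δ hδ => ?_
  have hder := (differentiableAt_of_deriv_ne_zero h0.ne').hasDerivAt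
  rw [hasDerivAt_iff_tendsto_slope] at hder
  have hev : ∀ᶠ t in nhdsWithin (x i) (Set.Ioi (x i)), deriv V (x i) / 2 < slope V (x i) t :=
    (hder.mono_left (nhdsWithin_mono _ fun t ht => ne_of_gt ht)).eventually_const_lt (by linarith)
  obtain ⟨t, ht, htI⟩ :=
    (hev.and (Ioo_mem_nhdsGT (show x i < x i + δ by linarith))).exists
  have hpos : 0 < t - x i := sub_pos.2 htI.1
  rw [slope_def_field, lt_div_iff₀ hpos] at ht
  obtain ⟨z, hz1, hz2, hz3⟩ := hV (x i) t htI.1 (by nlinarith)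
  set y : EuclideanSpace ℝ (Fin m) := x + EuclideanSpace.single i (z - x i) with hy
  have hyi : y i = z := by simp [hy]
  have hdist : dist x y = z - x i := by
    rw [hy, dist_self_add_right, PiLp.norm_single, Real.norm_of_nonneg (by linarith)]
  refine ⟨y, fun hyx => ?_, ?_, ?_⟩
  · rw [hyx] at hyi
    exact hz1.ne hyi
  · rw [dist_comm, hdist]
    linarith [htI.2]
  · rw [hdist, hyi]
    refine le_trans ?_ hz3
    rw [mul_assoc]
    refine mul_le_mul_of_nonneg_left ?_ hD
    nlinarith

/-- Lower bound for the slope energy: a continuous curve can be precomposed with a Lipschitz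
function so that the energy controls the distance between the endpoints. -/
lemma exists_le_sobolevEnergy_one {m : ℕ} (hm : 1 ≤ m) {q : ℝ} (hq : 1 ≤ q) :
    ∃ c : ℝ≥0∞, c ≠ 0 ∧ ∃ k : NNReal, ∀ (F : Type) [MetricSpace F] (g : ℝ → F), Continuous g →
      ∀ x y : F, (∀ t ≤ -1, g t = x) → (∀ t ≥ 1, g t = y) →
        ∃ w : EuclideanSpace ℝ (Fin m) → ℝ, LipschitzWith k w ∧
          c * ENNReal.ofReal (dist x y ^ q) ≤ sobolevEnergy 1 q (g ∘ w) (ball 0 1) := by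
  set i : Fin m := ⟨0, hm⟩
  have hq0 : 0 ≤ q := by linarith
  obtain ⟨a, ha, c₁, hc₁, hball⟩ := exists_mul_lintegral_le_lintegral_ball i
  obtain ⟨c₂, hc₂, hmom⟩ := exists_le_lintegral_rpow_of_lintegral_eq_one hq ha
  obtain ⟨k, hk⟩ := exists_reparametrization_Icc ha
  refine ⟨ENNReal.ofReal (1 / 2) ^ q * (c₁ * c₂), ?_, k, fun F _ g hg x y hx hy => ?_⟩
  · refine mul_ne_zero ?_ (mul_ne_zero hc₁ hc₂)
    exact (ENNReal.rpow_pos (by simp) ofReal_ne_top).ne'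
  rcases eq_or_ne x y with rfl | hxy
  · refine ⟨fun _ => 0, LipschitzWith.const' 0, ?_⟩
    rw [dist_self, Real.zero_rpow (by linarith), ENNReal.ofReal_zero, mul_zero]
    exact zero_le
  obtain ⟨h, V, hh, hV, hVm, hV0, hV1, hz⟩ := hk F g hg x y hxy hx hy
  have hVd : ∀ t, 0 ≤ deriv V t := fun t => hVm.deriv_nonneg
  have hV' : Measurable (deriv V) := measurable_deriv V
  have hac : AbsolutelyContinuousOnInterval V (-a) a :=
    hV.lipschitzOnWith.absolutelyContinuousOnInterval
  have hle : -a ≤ a := by linarith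
  have hone : ∫⁻ t in Set.Icc (-a) a, ENNReal.ofReal (deriv V t) = 1 := by
    have hint := (intervalIntegrable_iff_integrableOn_Icc_of_le hle).1
      hac.intervalIntegrable_deriv
    rw [← ofReal_integral_eq_lintegral_ofReal hint (Filter.Eventually.of_forall hVd),
      integral_Icc_eq_integral_Ioc, ← intervalIntegral.integral_of_le hle,
      hac.integral_deriv_eq_sub, hV0, hV1]
    simp
  refine ⟨fun x => h (x i), LipschitzWith.of_dist_le_mul fun x y => ?_, ?_⟩
  · refine (hh.dist_le_mul _ _).trans (mul_le_mul_of_nonneg_left ?_ k.2)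
    rw [dist_eq_norm, dist_eq_norm]
    exact PiLp.norm_apply_le (x - y) i
  set E := ∫⁻ x in ball (0 : EuclideanSpace ℝ (Fin m)) 1, ENNReal.ofReal (deriv V (x i)) ^ q
  have hE' : c₁ * c₂ ≤ E :=
    (mul_le_mul_right (hmom _ hVd hV' hone) c₁).trans
      (hball (fun t => ENNReal.ofReal (deriv V t) ^ q) (hV'.ennreal_ofReal.pow_const q))
  rw [sobolevEnergy, if_pos rfl]
  calc _ ≤ ENNReal.ofReal (1 / 2) ^ q * E * ENNReal.ofReal (dist x y ^ q) := by gcongr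
    _ = (ENNReal.ofReal (dist x y) * ENNReal.ofReal (1 / 2)) ^ q * E := by
        rw [ENNReal.mul_rpow_of_nonneg _ _ hq0, ENNReal.ofReal_rpow_of_nonneg dist_nonneg hq0]
        ring
    _ = ∫⁻ z in ball (0 : EuclideanSpace ℝ (Fin m)) 1,
          (ENNReal.ofReal (dist x y) * ENNReal.ofReal (1 / 2)) ^ q *
            ENNReal.ofReal (deriv V (z i)) ^ q :=
        (lintegral_const_mul' _ _ (ENNReal.rpow_ne_top_of_nonneg hq0
          (mul_ne_top ofReal_ne_top ofReal_ne_top))).symm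
    _ ≤ _ := by
        refine lintegral_mono fun z => ?_
        rw [← ENNReal.mul_rpow_of_nonneg _ _ hq0]
        refine ENNReal.rpow_le_rpow ?_ hq0
        rw [← ENNReal.ofReal_mul dist_nonneg, ← ENNReal.ofReal_mul (by positivity)]
        refine le_trans (le_of_eq ?_) (ofReal_deriv_le_metricSlope i dist_nonneg hz z)
        congr 1
        ring

/-- Lower bound for the Gagliardo energy of a map which is constant on two balls. -/
lemma exists_le_sobolevEnergy_of_ne_one {m : ℕ} (hm : 1 ≤ m) {r q : ℝ} (hr0 : 0 < r) (hr : r ≠ 1)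
    (hq : 1 ≤ q) :
    ∃ c : ℝ≥0∞, c ≠ 0 ∧ ∃ k : NNReal, ∀ (F : Type) [MetricSpace F] (g : ℝ → F) (x y : F),
      (∀ t ≤ -1, g t = x) → (∀ t ≥ 1, g t = y) →
        ∃ w : EuclideanSpace ℝ (Fin m) → ℝ, LipschitzWith k w ∧
          c * ENNReal.ofReal (dist x y ^ q) ≤ sobolevEnergy r q (g ∘ w) (ball 0 1) := by
  classical
  set i : Fin m := ⟨0, hm⟩
  have : Nonempty (Fin m) := ⟨i⟩
  set p : ℝ → EuclideanSpace ℝ (Fin m) := fun t => EuclideanSpace.single i t with hp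
  have hpn : ∀ t, ‖p t‖ = |t| := fun t => by simp [hp]
  have hcoord : ∀ x t, dist x (p t) < 1 / 4 → |x i - t| < 1 / 4 := by
    intro x t h
    rw [dist_eq_norm] at h
    have := (PiLp.norm_apply_le (x - p t) i).trans_lt h
    simpa [hp] using this
  have hsub : ∀ t, |t| ≤ 1 / 2 → ball (p t) (1 / 4) ⊆ ball 0 1 := by
    intro t ht
    refine ball_subset_ball' ?_
    rw [dist_zero_right, hpn]
    linarith
  set e : ℝ := m + r * q
  have he0 : 0 ≤ e := by positivity
  set A := ball (p (-(1 / 2))) (1 / 4)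
  set B := ball (p (1 / 2)) (1 / 4)
  have hA : A ⊆ ball 0 1 := hsub _ (by norm_num [abs_of_nonneg])
  have hB : B ⊆ ball 0 1 := hsub _ (by norm_num [abs_of_nonneg])
  refine ⟨ENNReal.ofReal (1 / 2 ^ e) * volume B * volume A, ?_, 4, fun F _ g x y hx hy => ?_⟩
  · refine mul_ne_zero (mul_ne_zero ?_ ?_) ?_
    · simpa using by positivity
    · exact (measure_ball_pos _ _ (by norm_num)).ne'
    · exact (measure_ball_pos _ _ (by norm_num)).ne'
  refine ⟨fun z => 4 * z i, LipschitzWith.of_dist_le_mul fun z z' => ?_, ?_⟩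
  · rw [Real.dist_eq, ← mul_sub, abs_mul, dist_eq_norm]
    have := PiLp.norm_apply_le (z - z') i
    simpa using this
  have hgA : ∀ z ∈ A, g (4 * z i) = x := fun z hz => by
    have := abs_lt.1 (hcoord z _ hz)
    exact hx _ (by linarith)
  have hgB : ∀ z ∈ B, g (4 * z i) = y := fun z hz => by
    have := abs_lt.1 (hcoord z _ hz)
    exact hy _ (by linarith)
  rw [sobolevEnergy, if_neg hr]
  calc _ = ∫⁻ _ in A, ∫⁻ _ in B, ENNReal.ofReal (dist x y ^ q / 2 ^ e) := by
        rw [setLIntegral_const, setLIntegral_const, div_eq_mul_one_div (dist x y ^ q),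
          ENNReal.ofReal_mul (p := dist x y ^ q) (by positivity)]
        ring
    _ ≤ ∫⁻ z in A, ∫⁻ z' in B, ENNReal.ofReal
          (dist ((g ∘ fun z => 4 * z i) z) ((g ∘ fun z => 4 * z i) z') ^ q / ‖z - z'‖ ^ e) := by
        refine setLIntegral_mono' measurableSet_ball fun z hz => ?_
        refine setLIntegral_mono' measurableSet_ball fun z' hz' => ?_
        refine ENNReal.ofReal_le_ofReal ?_
        simp only [Function.comp, hgA z hz, hgB z' hz']
        have h1 := abs_lt.1 (hcoord z _ hz)
        have h2 := abs_lt.1 (hcoord z' _ hz')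
        have h3 : z - z' ≠ 0 := fun h => by
          rw [sub_eq_zero.1 h] at h1
          linarith
        have h4 : ‖z - z'‖ ≤ 2 := by
          have hz1 := mem_ball_zero_iff.1 (hA hz)
          have hz2 := mem_ball_zero_iff.1 (hB hz')
          linarith [norm_sub_le z z']
        have h5 : 0 < ‖z - z'‖ := norm_pos_iff.2 h3
        gcongr
    _ ≤ ∫⁻ z in A, ∫⁻ z' in ball 0 1, ENNReal.ofReal
          (dist ((g ∘ fun z => 4 * z i) z) ((g ∘ fun z => 4 * z i) z') ^ q / ‖z - z'‖ ^ e) :=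
        lintegral_mono fun z => lintegral_mono_set hB
    _ ≤ _ := lintegral_mono_set hA

/-- Lower bound for the energy, for all `r ∈ (0, 1]`: if all Lipschitz reparametrizations of a
curve have finite energy, one of them controls the distance between the endpoints. -/
lemma exists_le_sobolevEnergy {m : ℕ} (hm : 1 ≤ m) {r q : ℝ} (hr : r ∈ Set.Ioc (0 : ℝ) 1)
    (hq : 1 ≤ q) :
    ∃ c : ℝ, 0 < c ∧ ∃ k : NNReal, ∀ (F : Type) [MetricSpace F] (g : ℝ → F) (x y : F),
      (∀ w : EuclideanSpace ℝ (Fin m) → ℝ, LipschitzWith 1 w →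
        sobolevEnergy r q (g ∘ w) (ball 0 1) < ⊤) →
      (∀ t ≤ -1, g t = x) → (∀ t ≥ 1, g t = y) →
        ∃ w : EuclideanSpace ℝ (Fin m) → ℝ, LipschitzWith k w ∧
          ENNReal.ofReal (c * dist x y ^ q) ≤ sobolevEnergy r q (g ∘ w) (ball 0 1) := by
  obtain ⟨c, hc, k, h⟩ : ∃ c : ℝ≥0∞, c ≠ 0 ∧ ∃ k : NNReal, ∀ (F : Type) [MetricSpace F]
      (g : ℝ → F) (x y : F), (∀ w : EuclideanSpace ℝ (Fin m) → ℝ, LipschitzWith 1 w →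
        sobolevEnergy r q (g ∘ w) (ball 0 1) < ⊤) →
      (∀ t ≤ -1, g t = x) → (∀ t ≥ 1, g t = y) →
        ∃ w : EuclideanSpace ℝ (Fin m) → ℝ, LipschitzWith k w ∧
          c * ENNReal.ofReal (dist x y ^ q) ≤ sobolevEnergy r q (g ∘ w) (ball 0 1) := by
    rcases eq_or_ne r 1 with rfl | hr1
    · obtain ⟨c, hc, k, h⟩ := exists_le_sobolevEnergy_one hm hq
      refine ⟨c, hc, k, fun F _ g x y hfin => h F g (continuous_iff_continuousAt.2 fun t => ?_) x y⟩
      by_contra hcon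
      obtain ⟨w, hw, htop⟩ := exists_lipschitzWith_sobolevEnergy_eq_top hm hq hcon
      exact (hfin w hw).ne htop
    · obtain ⟨c, hc, k, h⟩ := exists_le_sobolevEnergy_of_ne_one hm hr.1 hr1 hq
      exact ⟨c, hc, k, fun F _ g x y _ => h F g x y⟩
  have hc' : min c 1 ≠ ⊤ := ((min_le_right c 1).trans_lt one_lt_top).ne
  refine ⟨(min c 1).toReal, ENNReal.toReal_pos (by simp [hc]) hc', k,
    fun F _ g x y hfin hx hy => ?_⟩
  obtain ⟨w, hw, hle⟩ := h F g x y hfin hx hy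
  refine ⟨w, hw, le_trans ?_ hle⟩
  rw [ENNReal.ofReal_mul toReal_nonneg, ENNReal.ofReal_toReal hc']
  gcongr
  exact min_le_left _ _

/-- Acting condition: a uniform linear bound `E_{r,q}(f ∘ u) ≤ C₁ E_{s,p}(u)` for the
superposition operator forces `f` to be `(p/q)`-Hölder continuous (at small distances in
the critical case `sp = m`). -/
theorem superposition_acting_condition {m : ℕ} (hm : 1 ≤ m) (s r p q : ℝ)
    (hs : s ∈ Set.Ioc (0 : ℝ) 1) (hr : r ∈ Set.Ioc (0 : ℝ) 1)
    (hp : 1 ≤ p) (hq : 1 ≤ q) (hrq : r * q = s * p) (hspm : s * p ≤ m)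
    (N F : Type) [MetricSpace N] [MeasurableSpace N] [BorelSpace N]
    [MetricSpace F] [MeasurableSpace F] [BorelSpace F]
    (hN : LipschitzPathConnected N)
    (f : N → F) (hf : Measurable f)
    (C₁ : ℝ) (hC₁ : 0 < C₁)
    (hbound : ∀ u : EuclideanSpace ℝ (Fin m) → N, Measurable u →
      sobolevEnergy s p u (ball 0 1) < ⊤ →
      sobolevEnergy r q (f ∘ u) (ball 0 1)
        ≤ ENNReal.ofReal C₁ * sobolevEnergy s p u (ball 0 1)) :
    ∃ C : ℝ, 0 < C ∧ ∀ x y : N, (s * p = m → dist x y ≤ 1 / C) →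
      dist (f x) (f y) ≤ C * dist x y ^ (p / q) := by
  have hp0 : 0 < p := by linarith
  have hq0 : 0 < q := by linarith
  obtain ⟨C₀, hC₀, hupper⟩ := exists_sobolevEnergy_le_of_lipschitzWith hm hs hp
  obtain ⟨c, hc, k, hlower⟩ := exists_le_sobolevEnergy hm hr hq
  set A : ℝ := C₁ * (C₀ * (k : ℝ) ^ p) / c with hA
  have hA0 : 0 ≤ A := by positivity
  refine ⟨A ^ (1 / q) + 1, by positivity, fun x y _ => ?_⟩
  obtain ⟨γ, hγx, hγy, hγ⟩ := hN x y
  set clip : ℝ → ℝ := fun t => max (-1) (min t 1) with hclip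
  have hclipL : LipschitzWith 1 clip := (LipschitzWith.id.min_const 1).const_max (-1)
  have hγc : LipschitzWith (Real.toNNReal (dist x y)) (γ ∘ clip) := by
    simpa using hγ.comp hclipL
  have henergy : ∀ (K : NNReal) (w : EuclideanSpace ℝ (Fin m) → ℝ), LipschitzWith K w →
      sobolevEnergy r q ((f ∘ γ ∘ clip) ∘ w) (ball 0 1) ≤
        ENNReal.ofReal (C₁ * (C₀ * (dist x y * K) ^ p)) := by
    intro K w hw
    have hL := hγc.comp hw
    have hE := hupper N _ _ hL
    rw [NNReal.coe_mul, Real.coe_toNNReal _ dist_nonneg] at hE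
    rw [ENNReal.ofReal_mul hC₁.le]
    exact (hbound _ hL.continuous.measurable (hE.trans_lt ofReal_lt_top)).trans (by gcongr)
  obtain ⟨w, hw, hle⟩ := hlower F (f ∘ γ ∘ clip) (f x) (f y)
    (fun w hw => (henergy 1 w hw).trans_lt ofReal_lt_top)
    (fun t ht => by
      simp [hclip, min_eq_left (show t ≤ 1 by linarith), max_eq_left ht, hγx])
    (fun t ht => by simp [hclip, min_eq_right ht, hγy])
  have hreal := (ENNReal.ofReal_le_ofReal_iff (by positivity)).1 (hle.trans (henergy k w hw))
  have hpow : dist (f x) (f y) ^ q ≤ A * dist x y ^ p := by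
    rw [Real.mul_rpow dist_nonneg k.coe_nonneg] at hreal
    rw [hA, div_mul_eq_mul_div, le_div_iff₀ hc]
    linarith
  calc dist (f x) (f y) = (dist (f x) (f y) ^ q) ^ (1 / q) := by
        rw [← Real.rpow_mul dist_nonneg, mul_one_div_cancel hq0.ne', Real.rpow_one]
    _ ≤ (A * dist x y ^ p) ^ (1 / q) := by gcongr
    _ = A ^ (1 / q) * dist x y ^ (p / q) := by
        rw [Real.mul_rpow hA0 (by positivity), ← Real.rpow_mul dist_nonneg, mul_one_div]
    _ ≤ (A ^ (1 / q) + 1) * dist x y ^ (p / q) := by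
        gcongr
        linarith
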